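/- Fix a canonical linear ordering on all possible edges over a fixed vertex set V. Define μ(G) by deleting an edge e = {u,v} if and only if e is not among the first k edges (in canonical order) incident to u, or not among the first k edges incident to v. Then μ maps every graph into H_k (graphs of maximum degree at most k), μ(G) = G whenever G ∈ H_k, and for any two graphs G1, G2 whose edge sets differ in exactly one edge, the edge sets of μ(G1) and μ(G2) differ in at most 3 edges. Hence μ is a 3-smooth projection onto H_k in the edge-adjacency model. -/

import Mathlib

/-- The number of members of `E` incident to `v` that precede `e` in the order induced by `r`. -/
noncomputable def incidenceRank {V : Type*} (r : Sym2 V → ℕ) (E : Set (Sym2 V)) (v : V)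
    (e : Sym2 V) : ℕ :=
  {f | f ∈ E ∧ v ∈ f ∧ r f < r e}.ncard

/-- The members of `E` that are among the first `k` incident to each of their endpoints. -/
def keptEdges {V : Type*} (r : Sym2 V → ℕ) (k : ℕ) (E : Set (Sym2 V)) : Set (Sym2 V) :=
  {e | e ∈ E ∧ ∀ v ∈ e, incidenceRank r E v e < k}

/-- The graph on the edges of `G` that are among the first `k` at each of their endpoints. -/
def truncateDegree {V : Type*} (r : Sym2 V → ℕ) (k : ℕ) (G : SimpleGraph V) : SimpleGraph V :=
  SimpleGraph.fromEdgeSet (keptEdges r k G.edgeSet)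

theorem edgeSet_truncateDegree {V : Type*} (r : Sym2 V → ℕ) (k : ℕ) (G : SimpleGraph V) :
    (truncateDegree r k G).edgeSet = keptEdges r k G.edgeSet := by
  rw [truncateDegree, SimpleGraph.edgeSet_fromEdgeSet]
  ext e
  simp only [Set.mem_sdiff, and_iff_left_iff_imp]
  exact fun he => G.not_isDiag_of_mem_edgeSet he.1

theorem incidenceRank_insert_of_notMem {V : Type*} {r : Sym2 V → ℕ} (E : Set (Sym2 V)) {v : V}
    {e : Sym2 V} (hv : v ∉ e) (f : Sym2 V) :
    incidenceRank r (insert e E) v f = incidenceRank r E v f := by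
  refine congrArg Set.ncard (Set.ext fun g => ?_)
  constructor
  · rintro ⟨rfl | hg, hg'⟩
    · exact absurd hg'.1 hv
    · exact ⟨hg, hg'⟩
  · exact fun hg => ⟨Set.mem_insert_of_mem _ hg.1, hg.2⟩

section

variable {V : Type*} [Finite V] {r : Sym2 V → ℕ} {k : ℕ}

theorem incidenceRank_lt_of_lt {E : Set (Sym2 V)} {v : V} {e f : Sym2 V} (he : e ∈ E)
    (hv : v ∈ e) (h : r e < r f) : incidenceRank r E v e < incidenceRank r E v f := by
  refine Set.ncard_lt_ncard ⟨fun g hg => ⟨hg.1, hg.2.1, hg.2.2.trans h⟩, fun hsub => ?_⟩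
    (Set.toFinite _)
  exact lt_irrefl _ (hsub (show e ∈ _ from ⟨he, hv, h⟩)).2.2

theorem incidenceRank_injOn (hr : Function.Injective r) (E : Set (Sym2 V)) (v : V) :
    Set.InjOn (incidenceRank r E v) {e | e ∈ E ∧ v ∈ e} := by
  intro e he f hf h
  rcases lt_trichotomy (r e) (r f) with hlt | heq | hgt
  · exact absurd h (incidenceRank_lt_of_lt he.1 he.2 hlt).ne
  · exact hr heq
  · exact absurd h (incidenceRank_lt_of_lt hf.1 hf.2 hgt).ne'

theorem incidenceRank_mono {E F : Set (Sym2 V)} (h : E ⊆ F) (v : V) (e : Sym2 V) :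
    incidenceRank r E v e ≤ incidenceRank r F v e :=
  Set.ncard_le_ncard (fun _ hg => ⟨h hg.1, hg.2⟩) (Set.toFinite _)

theorem incidenceRank_insert_le (E : Set (Sym2 V)) (v : V) (e f : Sym2 V) :
    incidenceRank r (insert e E) v f ≤ incidenceRank r E v f + 1 := by
  refine (Set.ncard_le_ncard ?_ (Set.toFinite _)).trans (Set.ncard_insert_le e _)
  rintro g ⟨rfl | hg, hg'⟩
  · exact Set.mem_insert _ _
  · exact Set.mem_insert_of_mem _ ⟨hg, hg'⟩

theorem ncard_neighborSet_truncateDegree_le (hr : Function.Injective r) (G : SimpleGraph V)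
    (v : V) : ((truncateDegree r k G).neighborSet v).ncard ≤ k := by
  have hmem : ∀ w ∈ (truncateDegree r k G).neighborSet v,
      s(v, w) ∈ keptEdges r k G.edgeSet := fun w hw => by
    rwa [← edgeSet_truncateDegree, SimpleGraph.mem_edgeSet]
  refine (Set.ncard_le_ncard_of_injOn (t := Set.Iio k)
    (fun w => incidenceRank r G.edgeSet v s(v, w))
    (fun w hw => (hmem w hw).2 v (Sym2.mem_mk_left v w)) ?_
    (Set.finite_Iio k)).trans_eq (Set.ncard_Iio_nat k)
  intro w hw w' hw' h
  exact Sym2.congr_right.1 <| incidenceRank_injOn hr G.edgeSet v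
    ⟨(hmem w hw).1, Sym2.mem_mk_left v w⟩ ⟨(hmem w' hw').1, Sym2.mem_mk_left v w'⟩ h

theorem incidenceRank_lt_ncard_neighborSet (G : SimpleGraph V) {v : V} {e : Sym2 V}
    (he : e ∈ G.edgeSet) (hv : v ∈ e) :
    incidenceRank r G.edgeSet v e < (G.neighborSet v).ncard := by
  refine lt_of_lt_of_le (Set.ncard_lt_ncard (t := (fun w => s(v, w)) '' G.neighborSet v) ?_
    (Set.toFinite _)) (Set.ncard_image_le (Set.toFinite _))
  have himage : ∀ f ∈ G.edgeSet, v ∈ f → f ∈ (fun w => s(v, w)) '' G.neighborSet v := by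
    rintro f hf ⟨w, rfl⟩
    exact ⟨w, hf, rfl⟩
  exact ⟨fun f hf => himage f hf.1 hf.2.1,
    fun hsub => lt_irrefl _ (hsub (himage e he hv)).2.2⟩

theorem truncateDegree_eq_self (G : SimpleGraph V) (hG : ∀ v, (G.neighborSet v).ncard ≤ k) :
    truncateDegree r k G = G := by
  rw [← SimpleGraph.edgeSet_inj, edgeSet_truncateDegree]
  exact Set.ext fun e => ⟨fun he => he.1, fun he =>
    ⟨he, fun v hv => (incidenceRank_lt_ncard_neighborSet G he hv).trans_le (hG v)⟩⟩

theorem ncard_incidenceRank_add_one_eq_le_one (hr : Function.Injective r) (E : Set (Sym2 V))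
    (v : V) : {f | (f ∈ E ∧ v ∈ f) ∧ incidenceRank r E v f + 1 = k}.ncard ≤ 1 :=
  (Set.ncard_le_one (Set.toFinite _)).2 fun _ hf _ hg =>
    incidenceRank_injOn hr E v hf.1 hg.1 (Nat.succ_injective (hf.2.trans hg.2.symm))

theorem ncard_symmDiff_keptEdges_insert_le (hr : Function.Injective r) (E : Set (Sym2 V))
    (e : Sym2 V) :
    (symmDiff (keptEdges r k E) (keptEdges r k (insert e E))).ncard ≤ 3 := by
  induction e using Sym2.ind with | _ a b
  let last (v : V) : Set (Sym2 V) := {f | (f ∈ E ∧ v ∈ f) ∧ incidenceRank r E v f + 1 = k}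
  have hsub : symmDiff (keptEdges r k E) (keptEdges r k (insert s(a, b) E)) ⊆
      insert s(a, b) (last a ∪ last b) := by
    rintro f (⟨hf, hf'⟩ | ⟨⟨rfl | hfE, hf⟩, hf'⟩)
    · obtain ⟨v, hv, hk⟩ : ∃ v ∈ f, k ≤ incidenceRank r (insert s(a, b) E) v f := by
        by_contra! h
        exact hf' ⟨Set.mem_insert_of_mem _ hf.1, h⟩
      have hlt := hf.2 v hv
      have hle := incidenceRank_insert_le (r := r) E v s(a, b) f
      have hlast : f ∈ last v := ⟨⟨hf.1, hv⟩, by omega⟩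
      have hab : v ∈ s(a, b) := by
        by_contra hab
        rw [incidenceRank_insert_of_notMem E hab] at hk
        omega
      rcases Sym2.mem_iff.1 hab with rfl | rfl
      · exact Or.inr (Or.inl hlast)
      · exact Or.inr (Or.inr hlast)
    · exact Set.mem_insert _ _
    · exact absurd ⟨hfE, fun v hv =>
        (incidenceRank_mono (Set.subset_insert _ _) v f).trans_lt (hf v hv)⟩ hf'
  have ha : (last a).ncard ≤ 1 := ncard_incidenceRank_add_one_eq_le_one hr E a
  have hb : (last b).ncard ≤ 1 := ncard_incidenceRank_add_one_eq_le_one hr E b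
  have hle := Set.ncard_le_ncard hsub (Set.toFinite _)
  have hinsert := Set.ncard_insert_le s(a, b) (last a ∪ last b)
  have hunion := Set.ncard_union_le (last a) (last b)
  omega

theorem ncard_symmDiff_keptEdges_le (hr : Function.Injective r) {E F : Set (Sym2 V)}
    (h : (symmDiff E F).ncard = 1) :
    (symmDiff (keptEdges r k E) (keptEdges r k F)).ncard ≤ 3 := by
  obtain ⟨e, he⟩ := Set.ncard_eq_one.1 h
  have hmem : ∀ f, f ∈ symmDiff E F ↔ f = e := fun f => by rw [he, Set.mem_singleton_iff]
  simp only [Set.mem_symmDiff] at hmem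
  by_cases heE : e ∈ E
  · obtain rfl : E = insert e F := Set.ext fun f => by grind
    rw [symmDiff_comm]
    exact ncard_symmDiff_keptEdges_insert_le hr F e
  · obtain rfl : F = insert e E := Set.ext fun f => by grind
    exact ncard_symmDiff_keptEdges_insert_le hr E e

end


/-- There is a projection `μ` from graphs on a fixed finite vertex set `V` into
`H_k` (graphs of maximum degree at most `k`) — obtained by fixing a canonical ordering of
the edges and deleting every edge that is not among the first `k` edges incident to each of
its endpoints — such that `μ` fixes every graph of `H_k`, and whenever two graphs differ in
exactly one edge, their images differ in at most `3` edges.  Hence `μ` is a `3`-smooth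
projection onto `H_k` in the edge-adjacency model. -/
theorem stmt_3 {V : Type*} [Fintype V] (k : ℕ) :
    ∃ μ : SimpleGraph V → SimpleGraph V,
      (∀ G : SimpleGraph V, ∀ v : V, ((μ G).neighborSet v).ncard ≤ k) ∧
      (∀ G : SimpleGraph V, (∀ v : V, (G.neighborSet v).ncard ≤ k) → μ G = G) ∧
      (∀ G1 G2 : SimpleGraph V,
        (symmDiff G1.edgeSet G2.edgeSet).ncard = 1 →
        (symmDiff (μ G1).edgeSet (μ G2).edgeSet).ncard ≤ 3) := by
  obtain ⟨r, hr⟩ := exists_injective_nat (Sym2 V)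
  refine ⟨truncateDegree r k, ncard_neighborSet_truncateDegree_le hr, truncateDegree_eq_self,
    fun G1 G2 h => ?_⟩
  rw [edgeSet_truncateDegree, edgeSet_truncateDegree]
  exact ncard_symmDiff_keptEdges_le hr h
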